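/- Let (R,m) be an F-finite reduced excellent local ring of prime characteristic p > 0, let a ⊆ R be an ideal with a ∩ R° ≠ ∅, and let t ≥ 0 be a rational number. Let R̂ denote the m-adic completion of R, and suppose that condition (*) is satisfied for a^t over R and for (a·R̂)^t over R̂. Then τ((a·R̂)^t) = τ(a^t)·R̂. -/

import Mathlib

open scoped TensorProduct

universe u

variable (R : Type u) [CommRing R]

/-- `R°`: the set of elements of `R` not contained in any minimal prime ideal. -/
def Rcirc : Set R := {c : R | ∀ P ∈ minimalPrimes R, c ∉ P}

/-- The Frobenius power `I^{[q]}`: the ideal generated by the `q`-th powers of elements of `I`. -/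
def frobPow (I : Ideal R) (q : ℕ) : Ideal R := Ideal.span ((fun x : R => x ^ q) '' (I : Set R))

/-- The `a^t`-tight closure of an ideal `J`. -/
def tightClosure (p : ℕ) (a : Ideal R) (t : ℚ) (J : Ideal R) : Set R :=
  {z : R | ∃ c ∈ Rcirc R, ∃ e₀ : ℕ, ∀ e : ℕ, e₀ ≤ e →
    ∀ x ∈ a ^ ⌈t * (p : ℚ) ^ e⌉₊, c * z ^ p ^ e * x ∈ frobPow R J (p ^ e)}

/-- The generalized test ideal `τ(a^t) = ⋂_J (J : J^{*aᵗ})`. -/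
def testIdeal (p : ℕ) (a : Ideal R) (t : ℚ) : Ideal R :=
  ⨅ J : Ideal R, Submodule.colon J (Ideal.span (tightClosure R p a t J))

/-- `R` is F-finite: finitely generated over itself via the Frobenius endomorphism. -/
def FrobAlg (p e : ℕ) : Type u := R

instance : CommRing (FrobAlg R p e) := inferInstanceAs (CommRing R)

/-- The identity of `R`, viewed as a ring map `R →+* ᵉR`. -/
def FrobAlg.of (p e : ℕ) : R →+* FrobAlg R p e := RingHom.id R

noncomputable instance [ExpChar R p] : Algebra R (FrobAlg R p e) :=
  ((FrobAlg.of R p e).comp (iterateFrobenius R p e)).toAlgebra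

/-- F-finiteness of `R`. -/
def IsFFinite (p : ℕ) [ExpChar R p] : Prop := Module.Finite R (FrobAlg R p 1)

/-- `0^{*aᵗ}_M`, the `aᵗ`-tight closure of zero in a module `M`. -/
def moduleTC (p : ℕ) [ExpChar R p] (a : Ideal R) (t : ℚ)
    (M : Type u) [AddCommGroup M] [Module R M] : Set M :=
  {z : M | ∃ c ∈ Rcirc R, ∃ e₀ : ℕ, ∀ e : ℕ, e₀ ≤ e →
    ∀ x ∈ a ^ ⌈t * (p : ℚ) ^ e⌉₊,
      (FrobAlg.of R p e (c * x)) ⊗ₜ[R] z = (0 : TensorProduct R (FrobAlg R p e) M)}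

/-- `τ̃(aᵗ) = Ann_R (0^{*aᵗ}_E)`. -/
def tildeTau (p : ℕ) [ExpChar R p] (a : Ideal R) (t : ℚ)
    (E : Type u) [AddCommGroup E] [Module R E] : Ideal R :=
  (Submodule.span R (moduleTC R p a t E)).annihilator

/-- `E` is an injective hull of the `R`-module `M`. -/
def IsInjectiveHull (M : Type u) [AddCommGroup M] [Module R M]
    (E : Type u) [AddCommGroup E] [Module R E] : Prop :=
  Module.Injective R E ∧
    ∃ ι : M →ₗ[R] E, Function.Injective ι ∧
      ∀ N : Submodule R E, N ≠ ⊥ → N ⊓ LinearMap.range ι ≠ ⊥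

/-- `d` is an `aᵗ`-test element. -/
def IsTestElement (p : ℕ) [ExpChar R p] (a : Ideal R) (t : ℚ) (d : R) : Prop :=
  d ∈ Rcirc R ∧
    ∀ (M : Type u) [AddCommGroup M] [Module R M], Module.Finite R M →
      ∀ z : M, z ∈ moduleTC R p a t M ↔
        ∀ e : ℕ, ∀ x ∈ a ^ ⌈t * (p : ℚ) ^ e⌉₊,
          (FrobAlg.of R p e (d * x)) ⊗ₜ[R] z = (0 : TensorProduct R (FrobAlg R p e) M)



section Cartier

variable {R}

/-- `q⁻¹`-linear additive maps `A → A`. -/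
def CartMap (A : Type*) [CommRing A] (q : ℕ) : Set (A →+ A) :=
  {φ | ∀ s x, φ (s ^ q * x) = s * φ x}

/-- The ideal of all values at `c` of `p^e`-inverse linear maps. -/
def cartIdeal {A : Type*} [CommRing A] (p e : ℕ) (c : A) : Ideal A where
  carrier := {y | ∃ φ ∈ CartMap A (p ^ e), φ c = y}
  add_mem' := by
    rintro _ _ ⟨φ, hφ, rfl⟩ ⟨ψ, hψ, rfl⟩
    refine ⟨φ + ψ, fun s x => ?_, rfl⟩
    simp [hφ s x, hψ s x, mul_add]
  zero_mem' := ⟨0, fun s x => by simp, rfl⟩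
  smul_mem' := by
    rintro r _ ⟨φ, hφ, rfl⟩
    refine ⟨(AddMonoidHom.mulLeft r).comp φ, fun s x => ?_, rfl⟩
    simp [hφ s x]; ring

theorem mem_cartIdeal {A : Type*} [CommRing A] {p e : ℕ} {c y : A} :
    y ∈ cartIdeal p e c ↔ ∃ φ ∈ CartMap A (p ^ e), φ c = y := Iff.rfl

theorem CartMap.comp {A : Type*} [CommRing A] {p e f : ℕ} {φ ψ : A →+ A}
    (hφ : φ ∈ CartMap A (p ^ e)) (hψ : ψ ∈ CartMap A (p ^ f)) :
    ψ.comp φ ∈ CartMap A (p ^ (e + f)) := by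
  intro s x
  have : s ^ p ^ (e + f) = (s ^ p ^ f) ^ p ^ e := by rw [← pow_mul, pow_add, mul_comm]
  simp only [AddMonoidHom.comp_apply]
  rw [this, hφ, hψ]

theorem cartIdeal_trans {A : Type*} [CommRing A] {p e f : ℕ} {c y z : A}
    (hy : y ∈ cartIdeal p e c) (hz : z ∈ cartIdeal p f y) : z ∈ cartIdeal p (e + f) c := by
  obtain ⟨φ, hφ, rfl⟩ := hy
  obtain ⟨ψ, hψ, rfl⟩ := hz
  exact ⟨ψ.comp φ, CartMap.comp hφ hψ, rfl⟩

theorem cartIdeal_mul {A : Type*} [CommRing A] {p e : ℕ} {b c y : A}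
    (hy : y ∈ cartIdeal p e (b * c)) : y ∈ cartIdeal p e c := by
  obtain ⟨φ, hφ, rfl⟩ := hy
  refine ⟨φ.comp (AddMonoidHom.mulLeft b), fun s x => ?_, rfl⟩
  change φ (b * (s ^ p ^ e * x)) = s * φ (b * x)
  rw [← hφ, mul_left_comm]

theorem cartIdeal_pow_mul {A : Type*} [CommRing A] {p e : ℕ} {s c y : A}
    (hy : y ∈ cartIdeal p e c) : s * y ∈ cartIdeal p e (s ^ p ^ e * c) := by
  obtain ⟨φ, hφ, rfl⟩ := hy
  exact ⟨φ, hφ, hφ _ _⟩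

/-- A weak dual basis for Frobenius, with denominator `d`. -/
def WeakBasis (A : Type*) [CommRing A] (p : ℕ) (d : A) : Prop :=
  ∃ (k : ℕ) (φ : Fin k → A →+ A) (g : Fin k → A), (∀ i, φ i ∈ CartMap A (p ^ 1)) ∧
    ∀ w, d * w = ∑ i, (φ i w) ^ p * g i

section
variable {A : Type*} [CommRing A] {p : ℕ} [hp : Fact p.Prime] [ExpChar A p] {d : A}

theorem WeakBasis.d_mem (h : WeakBasis A p d) : d ∈ cartIdeal p 1 (1 : A) := by
  obtain ⟨k, φ, g, hφ, hw⟩ := h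
  have := hw 1
  rw [mul_one] at this
  rw [this]
  refine Ideal.sum_mem _ fun i _ => Ideal.mul_mem_right _ _ ?_
  exact Ideal.pow_mem_of_mem _ (mem_cartIdeal.2 ⟨φ i, hφ i, rfl⟩) _ hp.out.pos

theorem WeakBasis.reduced (h : WeakBasis A p d) (hd : d ∈ nonZeroDivisors A) {s : A}
    (hs : s ^ p = 0) : s = 0 := by
  obtain ⟨ψ, hψ, hd'⟩ := h.d_mem
  have := hψ s 1
  rw [pow_one, hs, zero_mul, map_zero, hd'] at this
  exact (mem_nonZeroDivisors_iff.1 hd).2 _ this.symm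

theorem WeakBasis.isReduced (h : WeakBasis A p d) (hd : d ∈ nonZeroDivisors A) :
    IsReduced A := by
  refine ⟨fun x hx => ?_⟩
  obtain ⟨n, hn⟩ := hx
  have key : ∀ m : ℕ, ∀ y : A, y ^ p ^ m = 0 → y = 0 := by
    intro m
    induction m with
    | zero => intro y hy; simpa using hy
    | succ m ih => 
      intro y hy
      rw [pow_succ, pow_mul] at hy
      exact ih _ (h.reduced hd hy)
  refine key n x ?_
  exact pow_eq_zero_of_le (Nat.lt_pow_self hp.out.one_lt).le hn

theorem WeakBasis.mul_mem_succ (h : WeakBasis A p d) {e : ℕ} {c y : A}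
    (hy : y ∈ cartIdeal p e c) : d * y ∈ cartIdeal p (e + 1) c := by
  have h1 : c * d ∈ cartIdeal p 1 c := by
    have := cartIdeal_pow_mul (s := c) h.d_mem
    rw [mul_one, pow_one] at this
    obtain ⟨m, hm⟩ := Nat.exists_eq_succ_of_ne_zero hp.out.ne_zero
    rw [hm, pow_succ, ← hm] at this
    exact cartIdeal_mul this
  have h2 : d ^ p ^ e * c ∈ cartIdeal p 1 c := by
    obtain ⟨m, hm⟩ := Nat.exists_eq_succ_of_ne_zero (pow_ne_zero e hp.out.ne_zero)
    rw [hm, pow_succ, mul_assoc, mul_comm d c]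
    exact Ideal.mul_mem_left _ _ h1
  rw [add_comm]
  exact cartIdeal_trans h2 (cartIdeal_pow_mul hy)

theorem WeakBasis.pow_mul_mem (h : WeakBasis A p d) {e n : ℕ} {c y : A}
    (hy : y ∈ cartIdeal p e c) (hn : e ≤ n) : d ^ (n - e) * y ∈ cartIdeal p n c := by
  obtain ⟨k, rfl⟩ := Nat.exists_eq_add_of_le hn
  simp only [Nat.add_sub_cancel_left]
  clear hn
  induction k with
  | zero => simpa using hy
  | succ k ih => 
    rw [pow_succ', mul_assoc, ← add_assoc]
    exact h.mul_mem_succ ih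

theorem WeakBasis.frob (h : WeakBasis A p d) (c : A) (e : ℕ) :
    ∃ m, d ^ m * c ∈ Ideal.span ((fun x : A => x ^ p ^ e) '' (cartIdeal p e c : Set A)) := by
  induction e with
  | zero =>
    refine ⟨0, Ideal.subset_span ⟨c, ⟨AddMonoidHom.id A, fun s x => by simp, rfl⟩, by simp⟩⟩
  | succ e ih =>
    obtain ⟨m, hm⟩ := ih
    refine ⟨p ^ e + m, ?_⟩
    rw [pow_add d, mul_assoc]
    revert hm
    generalize d ^ m * c = z
    intro hm
    induction hm using Submodule.span_induction with
    | zero => simp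
    | add x y _ _ hx hy => rw [mul_add]; exact add_mem hx hy
    | smul r x _ hx => 
      rw [smul_eq_mul, mul_left_comm]; exact Ideal.mul_mem_left _ _ hx
    | mem x hx =>
      obtain ⟨y, hy, rfl⟩ := hx
      obtain ⟨k, φ, g, hφ, hw⟩ := h
      simp only
      rw [← mul_pow, hw y, ← iterateFrobenius_def, map_sum]
      refine Ideal.sum_mem _ fun i _ => ?_
      rw [map_mul, iterateFrobenius_def, iterateFrobenius_def, ← pow_mul, ← pow_succ']
      exact Ideal.mul_mem_right _ _ (Ideal.subset_span
        ⟨_, cartIdeal_trans hy ⟨φ i, hφ i, rfl⟩, rfl⟩)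

theorem WeakBasis.exists_pow_mem [IsNoetherianRing A] (h : WeakBasis A p d)
    (hd : d ∈ nonZeroDivisors A) {c : A} (hc : c ∈ nonZeroDivisors A) :
    ∃ E, ∀ n, E ≤ n → ∃ m, d ^ m ∈ cartIdeal p n c := by
  have key : ∃ k, d ^ k ∈ (⨆ e, cartIdeal p e c : Ideal A) := by
    set J : Ideal A := ⨆ e, cartIdeal p e c with hJ
    let L := Localization.Away d
    have hpow : ∀ n : ℕ, algebraMap A L c ∈ (J.map (algebraMap A L)) ^ n := by
      intro n
      obtain ⟨m, hm⟩ := h.frob c n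
      have h1 : d ^ m * c ∈ J ^ n := by
        have : Ideal.span ((fun x : A => x ^ p ^ n) '' (cartIdeal p n c : Set A)) ≤ J ^ n := by
          rw [Ideal.span_le]
          rintro _ ⟨y, hy, rfl⟩
          have hyJ : y ∈ J := (le_iSup (fun e => cartIdeal p e c) n) hy
          exact Ideal.pow_le_pow_right (Nat.lt_pow_self hp.out.one_lt).le
            (Ideal.pow_mem_pow hyJ _)
        exact this hm
      have h2 := Ideal.mem_map_of_mem (algebraMap A L) h1
      rw [Ideal.map_pow, map_mul, map_pow] at h2
      have hu : IsUnit ((algebraMap A L d) ^ m) :=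
        (IsLocalization.Away.algebraMap_isUnit (S := L) d).pow m
      exact (Ideal.unit_mul_mem_iff_mem _ hu).1 h2
    have hinf : algebraMap A L c ∈
        (⨅ i : ℕ, (J.map (algebraMap A L)) ^ i • ⊤ : Submodule L L) := by
      rw [Submodule.mem_iInf]
      intro i
      simpa using hpow i
    have : IsNoetherianRing L := IsLocalization.isNoetherianRing (Submonoid.powers d) L ‹_›
    obtain ⟨⟨r, hr⟩, hrc⟩ := (Ideal.mem_iInf_smul_pow_eq_bot_iff _ _).1 hinf
    obtain ⟨⟨⟨j, hj⟩, ⟨_, k, rfl⟩⟩, hjk⟩ :=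
      (IsLocalization.mem_map_algebraMap_iff (Submonoid.powers d) L).1 hr
    refine ⟨k, ?_⟩
    have hinj : Function.Injective (algebraMap A L) :=
      IsLocalization.injective L (Submonoid.powers_le.2 hd)
    have e1 : j * c = d ^ k * c := by
      apply hinj
      simp only at hjk
      rw [map_mul, map_mul, ← hjk]
      have : r * algebraMap A L c = algebraMap A L c := hrc
      rw [mul_right_comm, this, mul_comm]
    have e2 : j = d ^ k := by
      have : (j - d ^ k) * c = 0 := by rw [sub_mul, e1, sub_self]
      exact sub_eq_zero.1 ((mem_nonZeroDivisors_iff.1 hc).2 _ this)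
    rwa [← e2]
  obtain ⟨k, hk⟩ := key
  suffices H : ∀ y ∈ (⨆ e, cartIdeal p e c : Ideal A),
      ∃ E, ∀ n, E ≤ n → ∃ m, d ^ m * y ∈ cartIdeal p n c by
    obtain ⟨E, hE⟩ := H _ hk
    refine ⟨E, fun n hn => ?_⟩
    obtain ⟨m, hm⟩ := hE n hn
    exact ⟨m + k, by rwa [pow_add]⟩
  intro y hy
  refine Submodule.iSup_induction (fun e => cartIdeal p e c)
    (motive := fun y => ∃ E, ∀ n, E ≤ n → ∃ m, d ^ m * y ∈ cartIdeal p n c) hy ?_ ?_ ?_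
  · intro e y hy
    exact ⟨e, fun n hn => ⟨n - e, h.pow_mul_mem hy hn⟩⟩
  · exact ⟨0, fun n _ => ⟨0, by simp⟩⟩
  · rintro x y ⟨E, hE⟩ ⟨F, hF⟩
    refine ⟨max E F, fun n hn => ?_⟩
    obtain ⟨m, hm⟩ := hE n (le_trans (le_max_left _ _) hn)
    obtain ⟨l, hl⟩ := hF n (le_trans (le_max_right _ _) hn)
    refine ⟨m + l, ?_⟩
    have : d ^ (m + l) * (x + y) = d ^ l * (d ^ m * x) + d ^ m * (d ^ l * y) := by ring
    rw [this]
    exact add_mem (Ideal.mul_mem_left _ _ hm) (Ideal.mul_mem_left _ _ hl)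

theorem WeakBasis.sq_mem (h : WeakBasis A p d) (n : ℕ) : d ^ 2 ∈ cartIdeal p n (1 : A) := by
  induction n with
  | zero =>
    refine ⟨AddMonoidHom.mulLeft (d ^ 2), fun s x => ?_, by simp⟩
    simp; ring
  | succ n ih =>
    have h1 : d ^ p ∈ cartIdeal p n (1 : A) := by
      obtain ⟨k, hk⟩ := Nat.exists_eq_add_of_le hp.out.two_le
      rw [hk, pow_add, ← hk]
      exact Ideal.mul_mem_right _ _ ih
    have h2 := cartIdeal_pow_mul (s := d) h.d_mem
    rw [pow_one, mul_one, ← sq] at h2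
    exact cartIdeal_trans h1 h2

theorem WeakBasis.cube_mem [IsNoetherianRing A] (h : WeakBasis A p d)
    (hd : d ∈ nonZeroDivisors A) {c : A} (hc : c ∈ nonZeroDivisors A) (e₀ : ℕ) :
    ∃ e, e₀ ≤ e ∧ d ^ 3 ∈ cartIdeal p e c := by
  obtain ⟨E, hE⟩ := h.exists_pow_mem hd hc
  obtain ⟨m, hm⟩ := hE (max E e₀) (le_max_left _ _)
  refine ⟨max E e₀ + m, le_trans (le_max_right _ _) (Nat.le_add_right _ _), ?_⟩
  have h1 : d ^ p ^ m ∈ cartIdeal p (max E e₀) c := by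
    obtain ⟨k, hk⟩ := Nat.exists_eq_add_of_le (Nat.lt_pow_self (n := m) hp.out.one_lt).le
    rw [hk, pow_add]
    exact Ideal.mul_mem_right _ _ hm
  have h2 := cartIdeal_pow_mul (s := d) (h.sq_mem m)
  rw [mul_one, ← pow_succ'] at h2
  exact cartIdeal_trans h1 h2

/-- The trace-type ideals `∑_{e ≥ e₀} ∑_φ φ(c a^⌈t p^e⌉)`. -/
def tauC {A : Type*} [CommRing A] (p : ℕ) (a : Ideal A) (t : ℚ) (c : A) (e₀ : ℕ) : Ideal A :=
  Ideal.span {y | ∃ e, e₀ ≤ e ∧ ∃ φ ∈ CartMap A (p ^ e),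
    ∃ x ∈ a ^ ⌈t * (p : ℚ) ^ e⌉₊, φ (c * x) = y}

theorem WeakBasis.tauC_le [IsNoetherianRing A] (h : WeakBasis A p d)
    (hd : d ∈ nonZeroDivisors A) {c : A} (hc : c ∈ nonZeroDivisors A) (e₀ : ℕ)
    (a : Ideal A) (t : ℚ) : tauC p a t (d ^ 3) 0 ≤ tauC p a t c e₀ := by
  obtain ⟨f, hf, ψ, hψ, hψc⟩ := h.cube_mem hd hc e₀
  refine Ideal.span_le.2 ?_
  rintro _ ⟨e, -, φ, hφ, x, hx, rfl⟩
  refine Ideal.subset_span ⟨f + e, by omega, ψ |> φ.comp, CartMap.comp hψ hφ, x ^ p ^ f, ?_, ?_⟩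
  · have h1 : x ^ p ^ f ∈ a ^ (⌈t * (p : ℚ) ^ e⌉₊ * p ^ f) := by
      rw [pow_mul]; exact Ideal.pow_mem_pow hx _
    refine Ideal.pow_le_pow_right ?_ h1
    rw [Nat.ceil_le]
    push_cast
    rw [pow_add, mul_comm ((p : ℚ) ^ f), ← mul_assoc]
    exact mul_le_mul_of_nonneg_right (Nat.le_ceil _) (by positivity)
  · rw [AddMonoidHom.comp_apply, mul_comm c, hψ, hψc, mul_comm]

end

end Cartier

section Duality

theorem exists_factor_of_surjective {A M N P : Type*} [CommRing A] [AddCommGroup M] [Module A M]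
    [AddCommGroup N] [Module A N] [AddCommGroup P] [Module A P] (π : M →ₗ[A] N)
    (hπ : Function.Surjective π) (l : M →ₗ[A] P) (h : LinearMap.ker π ≤ LinearMap.ker l) :
    ∃ φ : N →ₗ[A] P, ∀ x, φ (π x) = l x := by
  refine ⟨(LinearMap.ker π).liftQ l h ∘ₗ (π.quotKerEquivOfSurjective hπ).symm.toLinearMap,
    fun x => ?_⟩
  have : (π.quotKerEquivOfSurjective hπ).symm (π x) = (LinearMap.ker π).mkQ x := by
    rw [LinearEquiv.symm_apply_eq]; rfl
  simp [this]

theorem exists_factor_of_injective {A M N E : Type u} [CommRing A] [AddCommGroup M] [Module A M]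
    [AddCommGroup N] [Module A N] [AddCommGroup E] [Module A E] [Module.Injective A E]
    (T : M →ₗ[A] N) (h : M →ₗ[A] E) (hT : LinearMap.ker T ≤ LinearMap.ker h) :
    ∃ φ : N →ₗ[A] E, ∀ x, φ (T x) = h x := by
  obtain ⟨φ, hφ⟩ := Module.Injective.out (R := A) (Q := E)
    ((LinearMap.ker T).liftQ T le_rfl) (by
      rw [← LinearMap.ker_eq_bot]; exact Submodule.ker_liftQ_eq_bot _ _ _ le_rfl)
    ((LinearMap.ker T).liftQ h hT)
  exact ⟨φ, fun x => by simpa using hφ ((LinearMap.ker T).mkQ x)⟩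

theorem tmul_eq_zero_of_dual {A M E : Type u} [CommRing A] [IsNoetherianRing A]
    [AddCommGroup M] [Module A M] [Module.Finite A M] [AddCommGroup E] [Module A E]
    [Module.Injective A E] (w : M) (z : E) (hw : ∀ φ : M →ₗ[A] A, φ w • z = 0) :
    w ⊗ₜ[A] z = 0 := by
  obtain ⟨b, π, hπ⟩ := Module.Finite.exists_fin' A M
  obtain ⟨m, f, hf⟩ := Module.Finite.exists_fin' A (LinearMap.ker π)
  obtain ⟨v, rfl⟩ := hπ w
  let r : Fin m → Fin b → A := fun k => (f (Pi.single k 1)).1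
  let T : (Fin b → A) →ₗ[A] (Fin m → A) :=
    { toFun := fun l k => ∑ i, l i * r k i
      map_add' := by intro x y; ext k; simp [add_mul, Finset.sum_add_distrib]
      map_smul' := by intro c x; ext k; simp [mul_assoc, Finset.mul_sum] }
  let h : (Fin b → A) →ₗ[A] E :=
    { toFun := fun l => (∑ i, l i * v i) • z
      map_add' := by intro x y; simp [add_mul, Finset.sum_add_distrib, add_smul]
      map_smul' := by intro c x; simp [mul_assoc, ← Finset.mul_sum, mul_smul] }
  have hT : LinearMap.ker T ≤ LinearMap.ker h := by
    intro l hl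
    let L : (Fin b → A) →ₗ[A] A :=
      { toFun := fun x => ∑ i, l i * x i
        map_add' := by intro x y; simp [mul_add, Finset.sum_add_distrib]
        map_smul' := by intro c x; simp [mul_left_comm, Finset.mul_sum] }
    have hz : L ∘ₗ (LinearMap.ker π).subtype ∘ₗ f = 0 := by
      refine LinearMap.pi_ext' fun k => LinearMap.ext_ring ?_
      have := congrFun (LinearMap.mem_ker.1 hl) k
      simpa [T, L, r] using this
    have hk : LinearMap.ker π ≤ LinearMap.ker L := by
      intro x hx
      obtain ⟨y, hy⟩ := hf ⟨x, hx⟩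
      have := LinearMap.congr_fun hz y
      simpa [hy] using this
    obtain ⟨φ, hφ⟩ := exists_factor_of_surjective π hπ L hk
    have := hw φ
    rw [hφ] at this
    exact this
  obtain ⟨u, hu⟩ := exists_factor_of_injective T h hT
  have e1 : ∀ i, v i • z = ∑ k, r k i • u (Pi.single k 1) := by
    intro i
    have h1 : h (Pi.single i 1) = v i • z := by
      simp [h, Pi.single_apply]
    have h2 : T (Pi.single i 1) = fun k => r k i := by
      ext k; simp [T, Pi.single_apply]
    rw [← h1, ← hu, h2]
    conv_lhs => rw [pi_eq_sum_univ' (fun k => r k i)]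
    rw [map_sum]
    refine Finset.sum_congr rfl fun k _ => ?_
    rw [map_smul]
  have e2 : ∀ x : Fin b → A, π x = ∑ i, x i • π (Pi.single i 1) := by
    intro x
    conv_lhs => rw [pi_eq_sum_univ' x]
    rw [map_sum]
    refine Finset.sum_congr rfl fun k _ => ?_
    rw [map_smul]
  rw [e2 v, TensorProduct.sum_tmul]
  simp_rw [TensorProduct.smul_tmul, e1, TensorProduct.tmul_sum]
  rw [Finset.sum_comm]
  refine Finset.sum_eq_zero fun k _ => ?_
  simp_rw [← TensorProduct.smul_tmul]
  rw [← TensorProduct.sum_tmul, ← e2]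
  have : π (r k) = 0 := (f (Pi.single k 1)).2
  rw [this, TensorProduct.zero_tmul]

theorem tmul_eq_zero_iff_cart {A E : Type u} [CommRing A] [IsNoetherianRing A]
    (p e : ℕ) [ExpChar A p] [Module.Finite A (FrobAlg A p e)] [AddCommGroup E] [Module A E]
    [Module.Injective A E] (w : A) (z : E) :
    (FrobAlg.of A p e w) ⊗ₜ[A] z = (0 : TensorProduct A (FrobAlg A p e) E) ↔
      ∀ φ ∈ CartMap A (p ^ e), φ w • z = 0 := by
  have hsm : ∀ (s : A) (x : FrobAlg A p e), s • x = FrobAlg.of A p e (s ^ p ^ e) * x :=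
    fun s x => rfl
  constructor
  · intro h φ hφ
    let φ' : FrobAlg A p e →ₗ[A] A :=
      { toFun := fun x => φ x
        map_add' := fun x y => φ.map_add x y
        map_smul' := fun s x => hφ s x }
    have := congrArg ((TensorProduct.lid A E).toLinearMap ∘ₗ LinearMap.rTensor E φ') h
    simp only [LinearMap.comp_apply, LinearMap.rTensor_tmul, map_zero] at this
    exact this
  · intro h
    refine tmul_eq_zero_of_dual _ _ fun φ => ?_
    refine h ⟨⟨fun x => φ x, φ.map_zero⟩, fun x y => φ.map_add x y⟩ fun s x => ?_
    exact φ.map_smul s x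

theorem exists_separating {A E : Type u} [CommRing A] [IsLocalRing A] [AddCommGroup E] [Module A E]
    (hE : IsInjectiveHull A (A ⧸ IsLocalRing.maximalIdeal A) E) (I : Ideal A) (x : A)
    (hx : ∀ z : E, (∀ y ∈ I, y • z = 0) → x • z = 0) : x ∈ I := by
  by_contra hxI
  obtain ⟨hinj, ι, hι, -⟩ := hE
  -- the map `A → A/I`, `1 ↦ x`
  let T : A →ₗ[A] (A ⧸ I) := LinearMap.toSpanSingleton A (A ⧸ I) (Ideal.Quotient.mk I x)
  let h : A →ₗ[A] E := ι ∘ₗ (IsLocalRing.maximalIdeal A).mkQ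
  have hT : LinearMap.ker T ≤ LinearMap.ker h := by
    intro r hr
    have h1 : r * x ∈ I := by
      rw [← Ideal.Quotient.eq_zero_iff_mem, map_mul]
      exact hr
    have h2 : r ∈ IsLocalRing.maximalIdeal A := by
      rw [IsLocalRing.mem_maximalIdeal]
      intro hu
      exact hxI ((Ideal.unit_mul_mem_iff_mem _ hu).1 h1)
    have : (IsLocalRing.maximalIdeal A).mkQ r = 0 := by
      rw [Submodule.mkQ_apply, Submodule.Quotient.mk_eq_zero]; exact h2
    change ι ((IsLocalRing.maximalIdeal A).mkQ r) = 0
    rw [this, map_zero]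
  obtain ⟨u, hu⟩ := exists_factor_of_injective T h hT
  have h0 := hx (u (Ideal.Quotient.mk I 1)) (by
    intro y hy
    rw [← map_smul]
    have : y • (Ideal.Quotient.mk I 1) = 0 := by
      have : y • (Ideal.Quotient.mk I 1) = Ideal.Quotient.mk I (y * 1) := rfl
      rw [this, mul_one]; exact Ideal.Quotient.eq_zero_iff_mem.2 hy
    rw [this, map_zero])
  rw [← map_smul] at h0
  have h3 : x • (Ideal.Quotient.mk I 1) = T 1 := by
    simp only [T, LinearMap.toSpanSingleton_apply, one_smul]
    have : x • (Ideal.Quotient.mk I 1) = Ideal.Quotient.mk I (x * 1) := rfl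
    rw [this, mul_one]
  rw [h3, hu] at h0
  have h4 : (IsLocalRing.maximalIdeal A).mkQ (1 : A) = 0 := hι (by rw [map_zero]; exact h0)
  have h5 : (1 : A) ∈ IsLocalRing.maximalIdeal A := by
    rwa [Submodule.mkQ_apply, Submodule.Quotient.mk_eq_zero] at h4
  exact (IsLocalRing.maximalIdeal.isMaximal A).ne_top ((Ideal.eq_top_iff_one _).2 h5)

theorem mem_tildeTau_iff {A E : Type u} [CommRing A] [IsNoetherianRing A] [IsLocalRing A]
    (p : ℕ) [ExpChar A p] (hfin : ∀ e, Module.Finite A (FrobAlg A p e))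
    [AddCommGroup E] [Module A E]
    (hE : IsInjectiveHull A (A ⧸ IsLocalRing.maximalIdeal A) E) (a : Ideal A) (t : ℚ) (r : A) :
    r ∈ tildeTau A p a t E ↔ ∀ c ∈ Rcirc A, ∀ e₀, r ∈ tauC p a t c e₀ := by
  have hinj := hE.1
  have key : ∀ c e₀ (z : E), (∀ e : ℕ, e₀ ≤ e → ∀ x ∈ a ^ ⌈t * (p : ℚ) ^ e⌉₊,
      (FrobAlg.of A p e (c * x)) ⊗ₜ[A] z = (0 : TensorProduct A (FrobAlg A p e) E)) ↔
      ∀ y ∈ tauC p a t c e₀, y • z = 0 := by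
    intro c e₀ z
    constructor
    · intro h y hy
      induction hy using Submodule.span_induction with
      | zero => simp
      | add x y _ _ hx hy => rw [add_smul, hx, hy, add_zero]
      | smul s x _ hx => rw [smul_assoc, hx, smul_zero]
      | mem y hy =>
        obtain ⟨e, he, φ, hφ, x, hx, rfl⟩ := hy
        exact (tmul_eq_zero_iff_cart p e _ _).1 (h e he x hx) φ hφ
    · intro h e he x hx
      refine (tmul_eq_zero_iff_cart p e _ _).2 fun φ hφ => ?_
      exact h _ (Ideal.subset_span ⟨e, he, φ, hφ, x, hx, rfl⟩)
  unfold tildeTau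
  rw [Submodule.mem_annihilator_span]
  constructor
  · intro h c hc e₀
    refine exists_separating hE _ _ fun z hz => ?_
    exact h ⟨z, c, hc, e₀, (key c e₀ z).2 hz⟩
  · rintro h ⟨z, c, hc, e₀, hz⟩
    exact (key c e₀ z).1 hz r (h c hc e₀)

theorem mem_Rcirc_of_nzd {A : Type u} [CommRing A] {c : A} (hc : c ∈ nonZeroDivisors A) :
    c ∈ Rcirc A := by
  intro P hP hcP
  exact notMem_nonZeroDivisors_of_mem_mem_minimalPrimes hcP hP hc

theorem nzd_of_mem_Rcirc {A : Type u} [CommRing A] [IsReduced A] {c : A} (hc : c ∈ Rcirc A) :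
    c ∈ nonZeroDivisors A := by
  rw [mem_nonZeroDivisors_iff_right]
  intro x hx
  have : x ∈ sInf (minimalPrimes A) := by
    rw [Submodule.mem_sInf]
    intro P hP
    have := hP.1.1
    have h0 : x * c ∈ P := by rw [hx]; exact P.zero_mem
    exact (this.mem_or_mem h0).resolve_right (hc P hP)
  rw [minimalPrimes, Ideal.sInf_minimalPrimes] at this
  have h2 : nilradical A = ⊥ := nilradical_eq_bot_iff.2 ‹_›
  change x ∈ nilradical A at this
  rw [h2] at this
  simpa using this

theorem mem_tildeTau_iff' {A E : Type u} [CommRing A] [IsNoetherianRing A] [IsLocalRing A]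
    (p : ℕ) [Fact p.Prime] [ExpChar A p] (hfin : ∀ e, Module.Finite A (FrobAlg A p e))
    [AddCommGroup E] [Module A E]
    (hE : IsInjectiveHull A (A ⧸ IsLocalRing.maximalIdeal A) E) (a : Ideal A) (t : ℚ)
    {d : A} (hd : d ∈ nonZeroDivisors A) (h : WeakBasis A p d) :
    tildeTau A p a t E = tauC p a t (d ^ 3) 0 := by
  have := h.isReduced hd
  ext r
  rw [mem_tildeTau_iff p hfin hE]
  constructor
  · intro hr
    exact hr _ (mem_Rcirc_of_nzd (pow_mem hd 3)) 0
  · intro hr c hc e₀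
    exact h.tauC_le hd (nzd_of_mem_Rcirc hc) e₀ a t hr

end Duality

section Lemma5

theorem exists_weak_splitting {A M : Type u} [CommRing A] [IsNoetherianRing A] [IsReduced A]
    [AddCommGroup M] [Module A M] [Module.Finite A M] (P : Ideal A) (hP : P ∈ minimalPrimes A) :
    ∃ s : A, s ∉ P ∧ ∃ (n : ℕ) (f : M →ₗ[A] (Fin n → A)) (g : (Fin n → A) →ₗ[A] M),
      ∀ x, g (f x) = s • x := by
  haveI : P.IsPrime := hP.1.1
  let K := Localization.AtPrime P
  have hsub := IsLocalization.subsingleton_primeSpectrum_of_mem_minimalPrimes P hP K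
  have hK : IsField K := by
    haveI : IsReduced K := isReduced_localizationPreserves P.primeCompl K inferInstance
    rw [IsLocalRing.isField_iff_maximalIdeal_eq]
    rw [eq_bot_iff]
    intro x hx
    rw [Ideal.mem_bot]
    refine IsNilpotent.eq_zero ?_
    rw [← mem_nilradical, nilradical_eq_sInf]
    refine Ideal.mem_sInf.2 fun {J} hJ => ?_
    have : (⟨J, hJ⟩ : PrimeSpectrum K) = ⟨IsLocalRing.maximalIdeal K, inferInstance⟩ :=
      Subsingleton.elim _ _
    have := congrArg PrimeSpectrum.asIdeal this
    simp only at this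
    rw [this]; exact hx
  letI : Field K := hK.toField
  obtain ⟨n, π, hπ⟩ := Module.Finite.exists_fin' A M
  let lM := LocalizedModule.mkLinearMap P.primeCompl M
  let lF := LocalizedModule.mkLinearMap P.primeCompl (Fin n → A)
  let πK := IsLocalizedModule.map P.primeCompl lF lM π
  have hπK : Function.Surjective πK := IsLocalizedModule.map_surjective _ _ _ _ hπ
  let πK' : LocalizedModule P.primeCompl (Fin n → A) →ₗ[K] LocalizedModule P.primeCompl M :=
    πK.extendScalarsOfIsLocalization P.primeCompl K
  have hπK' : Function.Surjective πK' := hπK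
  obtain ⟨σ, hσ⟩ := Module.projective_lifting_property πK' LinearMap.id hπK'
  haveI : Module.FinitePresentation A M := Module.finitePresentation_of_finite A M
  obtain ⟨h, s, hs⟩ := Module.FinitePresentation.exists_lift_of_isLocalizedModule P.primeCompl lF
    ((σ.restrictScalars A) ∘ₗ lM)
  have key : lM ∘ₗ (π ∘ₗ h) = lM ∘ₗ (s • LinearMap.id) := by
    ext x
    have h1 : lM (π (h x)) = πK (lF (h x)) := by
      simp only [πK]
      rw [IsLocalizedModule.map_apply]
    have h2 : lF (h x) = s • σ (lM x) := LinearMap.congr_fun hs x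
    have h3 : πK (σ (lM x)) = lM x := LinearMap.congr_fun hσ (lM x)
    simp only [LinearMap.comp_apply]
    rw [h1, h2, Submonoid.smul_def, map_smul, h3]
    simp [Submonoid.smul_def]
  obtain ⟨s', hs'⟩ := Module.Finite.exists_smul_of_comp_eq_of_isLocalizedModule P.primeCompl lM _ _ key
  refine ⟨s' * s, (s' * s).2, n, h, (s' : A) • π, fun x => ?_⟩
  have := LinearMap.congr_fun hs' x
  simpa [Submonoid.smul_def, mul_smul] using this

theorem frobAlg_smul {A : Type u} [CommRing A] {p e : ℕ} [ExpChar A p] (s : A)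
    (x : FrobAlg A p e) : s • x = FrobAlg.of A p e (s ^ p ^ e) * x := by
  rw [Algebra.smul_def]
  congr 1

/-- coordinate maps -/
noncomputable def cartOfLin {A : Type u} [CommRing A] {p e : ℕ} [ExpChar A p] (f : FrobAlg A p e →ₗ[A] A) :
    A →+ A := f.toAddMonoidHom.comp (FrobAlg.of A p e).toAddMonoidHom

theorem cartOfLin_mem {A : Type u} [CommRing A] {p e : ℕ} [ExpChar A p]
    (f : FrobAlg A p e →ₗ[A] A) : cartOfLin f ∈ CartMap A (p ^ e) := by
  intro s x
  have := f.map_smul s (FrobAlg.of A p e x)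
  rw [frobAlg_smul, ← map_mul] at this
  exact this

theorem exists_weakBasis {A : Type u} [CommRing A] [IsNoetherianRing A] [IsReduced A]
    (p : ℕ) [hp : Fact p.Prime] [ExpChar A p] (hF : Module.Finite A (FrobAlg A p 1)) :
    ∃ d ∈ nonZeroDivisors A, WeakBasis A p d := by
  let L : A →ₗ[A] (A → A) :=
    { toFun := fun d w => d * w
      map_add' := by intro x y; ext w; simp [add_mul]
      map_smul' := by intro x y; ext w; simp [mul_assoc] }
  let T : Ideal A := (Submodule.span A
    (Set.range fun φ : CartMap A (p ^ 1) => fun w : A => (φ.1 w) ^ p)).comap L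
  have hT : ∀ P ∈ minimalPrimes A, ¬ (T : Set A) ⊆ P := by
    intro P hP hTP
    obtain ⟨s, hs, n, f, g, hfg⟩ := exists_weak_splitting (M := FrobAlg A p 1) P hP
    have : s ^ p ∈ T := by
      change L (s ^ p) ∈ Submodule.span A (Set.range fun φ : CartMap A (p ^ 1) => fun w : A => (φ.1 w) ^ p)
      have hL : L (s ^ p) = ∑ i, (show A from g (Pi.single i 1)) •
          (fun w : A => (cartOfLin ((LinearMap.proj i).comp f) w) ^ p) := by
        ext w
        have h1 := hfg (FrobAlg.of A p 1 w)
        rw [frobAlg_smul, ← map_mul, pow_one] at h1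
        have h2 : f (FrobAlg.of A p 1 w) =
            ∑ i, f (FrobAlg.of A p 1 w) i • (Pi.single i (1 : A) : Fin n → A) := by
          ext j; simp [Finset.sum_apply, Pi.single_apply]
        rw [h2, map_sum] at h1
        change s ^ p * w = _
        rw [Finset.sum_apply]
        refine (show s ^ p * w = FrobAlg.of A p 1 (s ^ p * w) from rfl).trans (h1.symm.trans ?_)
        refine Finset.sum_congr rfl fun i _ => ?_
        rw [map_smul, frobAlg_smul, pow_one]
        exact mul_comm _ _
      rw [hL]
      refine Submodule.sum_mem _ fun i _ => Submodule.smul_mem _ _ (Submodule.subset_span ?_)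
      exact ⟨⟨_, cartOfLin_mem _⟩, rfl⟩
    exact hs ((hP.1.1).mem_of_pow_mem _ (hTP this))
  have : ∃ d ∈ T, d ∈ Rcirc A := by
    by_contra hcon
    push Not at hcon
    have hsub : (T : Set A) ⊆ ⋃ P ∈ minimalPrimes A, (P : Set A) := by
      intro d hd
      have := hcon d hd
      simp only [Rcirc, Set.mem_setOf_eq, not_forall, not_not] at this
      obtain ⟨P, hP, hdP⟩ := this
      exact Set.mem_biUnion hP hdP
    have hfin := minimalPrimes.finite_of_isNoetherianRing A
    obtain ⟨P, hP, hle⟩ := (Ideal.subset_union_prime_finite (f := id) hfin ⊥ ⊥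
      (fun P hP _ _ => hP.1.1)).1 hsub
    exact hT P hP hle
  obtain ⟨d, hdT, hd⟩ := this
  refine ⟨d, nzd_of_mem_Rcirc hd, ?_⟩
  obtain ⟨n, c, v, hv⟩ := Submodule.mem_span_set'.1 (show L d ∈ _ from hdT)
  choose φ hφ using fun i => (v i).2
  refine ⟨n, fun i => (φ i).1, c, fun i => (φ i).2, fun w => ?_⟩
  have := congrFun hv w
  rw [Finset.sum_apply] at this
  refine this.symm.trans (Finset.sum_congr rfl fun i _ => ?_)
  rw [Pi.smul_apply, ← hφ i, smul_eq_mul, mul_comm]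

/-- Generation of `A` over its `q`-th powers. -/
def GenPow (A : Type*) [CommRing A] (q : ℕ) : Prop :=
  ∃ (k : ℕ) (g : Fin k → A), ∀ w : A, ∃ c : Fin k → A, w = ∑ i, c i ^ q * g i

theorem genPow_of_finite {A : Type u} [CommRing A] {p e : ℕ} [ExpChar A p]
    (h : Module.Finite A (FrobAlg A p e)) : GenPow A (p ^ e) := by
  obtain ⟨n, π, hπ⟩ := Module.Finite.exists_fin' A (FrobAlg A p e)
  refine ⟨n, fun i => (show A from π (Pi.single i 1)), fun w => ?_⟩
  obtain ⟨c, hc⟩ := hπ (FrobAlg.of A p e w)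
  refine ⟨c, ?_⟩
  have h2 : c = ∑ i, c i • (Pi.single i (1 : A) : Fin n → A) := by
    ext j; simp [Finset.sum_apply, Pi.single_apply]
  rw [h2, map_sum] at hc
  refine (show w = FrobAlg.of A p e w from rfl).trans (hc.symm.trans ?_)
  refine Finset.sum_congr rfl fun i _ => ?_
  rw [map_smul, frobAlg_smul]
  rfl

theorem finite_of_genPow {A : Type u} [CommRing A] {p e : ℕ} [ExpChar A p]
    (h : GenPow A (p ^ e)) : Module.Finite A (FrobAlg A p e) := by
  obtain ⟨k, g, hg⟩ := h
  refine Module.Finite.of_surjective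
    (Fintype.linearCombination A (fun i => FrobAlg.of A p e (g i))) fun w => ?_
  obtain ⟨c, hc⟩ := hg w
  refine ⟨c, ?_⟩
  rw [Fintype.linearCombination_apply]
  refine Eq.trans ?_ hc.symm
  refine Finset.sum_congr rfl fun i _ => ?_
  rw [frobAlg_smul]
  rfl

theorem genPow_pow {A : Type u} [CommRing A] {p : ℕ} [ExpChar A p]
    (h : GenPow A (p ^ 1)) (e : ℕ) : GenPow A (p ^ e) := by
  induction e with
  | zero => exact ⟨1, fun _ => 1, fun w => ⟨fun _ => w, by simp⟩⟩
  | succ e ih =>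
    obtain ⟨k, g, hg⟩ := h
    obtain ⟨l, g', hg'⟩ := ih
    let eq := (finProdFinEquiv (m := l) (n := k)).symm
    refine ⟨l * k, fun i => g (eq i).2 ^ p ^ e * g' (eq i).1, fun w => ?_⟩
    obtain ⟨c, hc⟩ := hg' w
    choose b hb using fun i => hg (c i)
    refine ⟨fun i => b (eq i).1 (eq i).2, ?_⟩
    rw [hc, eq.sum_comp (fun i => b i.1 i.2 ^ p ^ (e + 1) * (g i.2 ^ p ^ e * g' i.1)),
      Fintype.sum_prod_type]
    refine Finset.sum_congr rfl fun i _ => ?_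
    conv_lhs => rw [hb i, sum_pow_char_pow p]
    rw [Finset.sum_mul]
    refine Finset.sum_congr rfl fun j _ => ?_
    rw [mul_pow, ← pow_mul, pow_one, pow_succ']
    ring

end Lemma5

section Compl

/-- Abstract properties of the `m`-adic completion `A → B`. -/
structure IsCompl' (A B : Type u) [CommRing A] [CommRing B] [Algebra A B] (m : Ideal A) : Prop where
  complete : IsAdicComplete (m.map (algebraMap A B)) B
  approx : ∀ (s : B) (n : ℕ), ∃ w : A, s - algebraMap A B w ∈ (m.map (algebraMap A B)) ^ n
  comap : ∀ (n : ℕ) (w : A), algebraMap A B w ∈ (m.map (algebraMap A B)) ^ n → w ∈ m ^ n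

theorem isCompl_adicCompletion {A : Type u} [CommRing A] (m : Ideal A) (hm : m.FG) :
    IsCompl' A (AdicCompletion m A) m := by
  have key : ∀ (n : ℕ) (x : AdicCompletion m A),
      x ∈ (m.map (algebraMap A (AdicCompletion m A))) ^ n ↔ AdicCompletion.eval m A n x = 0 := by
    intro n x
    rw [← Ideal.map_pow, ← Submodule.restrictScalars_mem A, ← Ideal.smul_top_eq_map,
      AdicCompletion.pow_smul_top_eq_ker_eval hm, LinearMap.mem_ker]
  refine ⟨AdicCompletion.isAdicComplete_self m hm, fun s n => ?_, fun n w hw => ?_⟩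
  · obtain ⟨w, hw⟩ := Submodule.Quotient.mk_surjective _ (AdicCompletion.eval m A n s)
    refine ⟨w, ?_⟩
    rw [key, map_sub, ← hw, sub_eq_zero]
    rfl
  · rw [key] at hw
    have : (Submodule.Quotient.mk w : A ⧸ (m ^ n • ⊤ : Submodule A A)) = 0 := hw
    rw [Submodule.Quotient.mk_eq_zero] at this
    simpa using this

theorem IsCompl'.isNoetherianRing {A B : Type u} [CommRing A] [CommRing B] [Algebra A B]
    {m : Ideal A} (h : IsCompl' A B m) [IsNoetherianRing A] : IsNoetherianRing B := by
  set N := m.map (algebraMap A B) with hN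
  have := h.complete
  obtain ⟨r, x, hx⟩ := Submodule.fg_iff_exists_fin_generating_family.1 (IsNoetherian.noetherian m)
  let P := MvPolynomial (Fin r) A
  let J : Ideal P := MvPolynomial.idealOfVars (Fin r) A
  let C := AdicCompletion J P
  have hJ : J.FG := MvPolynomial.idealOfVars_fg _ _
  have hC : IsNoetherianRing C :=
    isNoetherianRing_of_ringEquiv _ (MvPowerSeries.toAdicCompletionAlgEquiv (Fin r) A).toRingEquiv
  let f : P →+* B := (MvPolynomial.aeval (fun i => algebraMap A B (x i))).toRingHom
  have hfJ : J.map f = N := by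
    rw [hN, ← hx]
    simp only [J, MvPolynomial.idealOfVars]
    rw [Ideal.map_span, ← Set.range_comp]
    change _ = Ideal.map _ (Ideal.span (Set.range x))
    rw [Ideal.map_span, ← Set.range_comp]
    congr 2
    ext i
    change MvPolynomial.aeval (fun i => algebraMap A B (x i)) (MvPolynomial.X i) = _
    rw [MvPolynomial.aeval_X]
    rfl
  have hle : ∀ n, J ^ n ≤ (N ^ n).comap f := fun n => by
    rw [← Ideal.map_le_iff_le_comap, Ideal.map_pow, hfJ]
  let F' : (n : ℕ) → C →+* B ⧸ N ^ n := fun n =>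
    (Ideal.quotientMap (N ^ n) f (hle n)).comp (AdicCompletion.evalₐ J n : C →+* P ⧸ J ^ n)
  have hF' : ∀ {k n : ℕ} (hkn : k ≤ n), (Ideal.Quotient.factorPow N hkn).comp (F' n) = F' k := by
    intro k n hkn
    ext c
    obtain ⟨c, rfl⟩ := AdicCompletion.mk_surjective J P c
    have e1 : ∀ n, F' n (AdicCompletion.mk J P c) = Ideal.Quotient.mk _ (f (c.1 n)) := by
      intro n
      change Ideal.quotientMap _ _ (hle n) (AdicCompletion.evalₐ J n (AdicCompletion.mk J P c)) = _
      rw [AdicCompletion.evalₐ_mk, Ideal.quotientMap_mk]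
    rw [RingHom.comp_apply, e1, e1, Ideal.Quotient.factor_mk]
    rw [Ideal.Quotient.eq, ← map_sub]
    refine hle k ?_
    have := c.2 hkn
    rw [SModEq.sub_mem] at this
    have h2 : (c.1 k - c.1 n) ∈ J ^ k := by simpa using this
    rw [← neg_sub]
    exact neg_mem h2
  let F : C →+* B := IsAdicComplete.liftRingHom N F' hF'
  have hFa : ∀ q : P, F (algebraMap P C q) = f q := by
    intro q
    refine (IsHausdorff.eq_iff_smodEq (I := N)).2 fun n => ?_
    rw [SModEq.sub_mem, smul_eq_mul, Ideal.mul_top]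
    rw [← Ideal.Quotient.eq, IsAdicComplete.mk_liftRingHom]
    simp only [F', RingHom.comp_apply]
    change Ideal.quotientMap _ _ _ (AdicCompletion.evalₐ J n (AdicCompletion.of J P q)) = _
    rw [AdicCompletion.evalₐ_of, Ideal.quotientMap_mk]
  have hcomp : F.comp (algebraMap P C) = f := RingHom.ext hFa
  have hmap : (J.map (algebraMap P C)).map F = N := by
    rw [Ideal.map_map, hcomp, hfJ]
  have h1 := AdicCompletion.isAdicComplete_self J hJ
  have h2 : IsHausdorff ((J.map (algebraMap P C)).map F) B := by rw [hmap]; infer_instance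
  have hsurj : Function.Surjective F := by
    refine surjective_of_mk_map_comp_surjective (I := J.map (algebraMap P C)) F fun b => ?_
    obtain ⟨b, rfl⟩ := Ideal.Quotient.mk_surjective b
    obtain ⟨w, hw⟩ := h.approx b 1
    refine ⟨algebraMap P C (MvPolynomial.C w), ?_⟩
    rw [RingHom.comp_apply, hFa, Ideal.Quotient.eq, hmap]
    rw [pow_one] at hw
    have : f (MvPolynomial.C w) = algebraMap A B w :=
      MvPolynomial.aeval_C _ _
    rw [this, ← neg_sub]
    exact neg_mem hw
  exact isNoetherianRing_of_surjective _ _ F hsurj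

theorem frobPow_mul {A : Type u} [CommRing A] (I J : Ideal A) (q : ℕ) :
    frobPow A I q * frobPow A J q ≤ frobPow A (I * J) q := by
  rw [frobPow, frobPow, Ideal.span_mul_span', Ideal.span_le]
  rintro _ ⟨_, ⟨x, hx, rfl⟩, _, ⟨y, hy, rfl⟩, rfl⟩
  refine Ideal.subset_span ⟨x * y, Ideal.mul_mem_mul hx hy, mul_pow _ _ _⟩

theorem frobPow_pow {A : Type u} [CommRing A] (I : Ideal A) (q n : ℕ) :
    frobPow A I q ^ n ≤ frobPow A (I ^ n) q := by
  induction n with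
  | zero =>
    rw [pow_zero, pow_zero]
    have : frobPow A (1 : Ideal A) q = ⊤ := (Ideal.eq_top_iff_one _).2
      (Ideal.subset_span ⟨1, by simp, one_pow _⟩)
    rw [this]; exact le_top
  | succ n ih =>
    rw [pow_succ, pow_succ]
    exact (Ideal.mul_mono_left ih).trans (frobPow_mul _ _ _)

theorem exists_pow_le_frobPow {A : Type u} [CommRing A] (I : Ideal A) (hI : I.FG) (q : ℕ) :
    ∃ K, 0 < K ∧ ∀ n, I ^ (K * n) ≤ frobPow A (I ^ n) q := by
  obtain ⟨K, hK⟩ := Ideal.exists_pow_le_of_le_radical_of_fg (I := I) (J := frobPow A I q)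
    (fun x hx => ⟨q, Ideal.subset_span ⟨x, hx, rfl⟩⟩) hI
  refine ⟨K + 1, K.succ_pos, fun n => ?_⟩
  rw [pow_mul]
  exact (Ideal.pow_right_mono ((Ideal.pow_le_pow_right K.le_succ).trans hK) n).trans
    (frobPow_pow _ _ _)

theorem CartMap.map_frobPow {A : Type u} [CommRing A] {q : ℕ} {φ : A →+ A} (hφ : φ ∈ CartMap A q)
    (I : Ideal A) {x : A} (hx : x ∈ frobPow A I q) : φ x ∈ I := by
  suffices H : ∀ r, φ (x * r) ∈ I by simpa using H 1
  refine Submodule.span_induction (p := fun x _ => ∀ r, φ (x * r) ∈ I) ?_ ?_ ?_ ?_ hx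
  · rintro _ ⟨y, hy, rfl⟩ r
    rw [hφ]
    exact Ideal.mul_mem_right _ _ hy
  · intro r; simp
  · intro x y _ _ h1 h2 r
    rw [add_mul, map_add]; exact add_mem (h1 r) (h2 r)
  · intro a x _ h1 r
    have := h1 (a * r)
    rwa [smul_eq_mul, mul_comm a, mul_assoc]

variable {A B : Type u} [CommRing A] [CommRing B] [Algebra A B] {m : Ideal A}

theorem IsCompl'.eq_of_forall (h : IsCompl' A B m) {x y : B}
    (hxy : ∀ n, x - y ∈ (m.map (algebraMap A B)) ^ n) : x = y := by
  have := h.complete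
  refine (IsHausdorff.eq_iff_smodEq (I := m.map (algebraMap A B))).2 fun n => ?_
  rw [SModEq.sub_mem, smul_eq_mul, Ideal.mul_top]
  exact hxy n

theorem IsCompl'.extend (h : IsCompl' A B m) (hm : m.FG) {q : ℕ} {φ : A →+ A}
    (hφ : φ ∈ CartMap A q) :
    ∃ ψ ∈ CartMap B q, ∀ w, ψ (algebraMap A B w) = algebraMap A B (φ w) := by
  set N := m.map (algebraMap A B) with hN
  have := h.complete
  obtain ⟨K, hK0, hK⟩ := exists_pow_le_frobPow m hm q
  have hle : ∀ n (w : A), algebraMap A B w ∈ N ^ (K * n) → algebraMap A B (φ w) ∈ N ^ n := by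
    intro n w hw
    rw [hN, ← Ideal.map_pow]
    exact Ideal.mem_map_of_mem _ (CartMap.map_frobPow hφ _ (hK n (h.comap _ _ hw)))
  have hmono : ∀ {i j : ℕ}, i ≤ j → N ^ j ≤ N ^ i := fun hij => Ideal.pow_le_pow_right hij
  have hex : ∀ s : B, ∃ L : B, ∀ n (w : A), s - algebraMap A B w ∈ N ^ (K * n) →
      L - algebraMap A B (φ w) ∈ N ^ n := by
    intro s
    choose w hw using h.approx s
    obtain ⟨L, hL⟩ := IsPrecomplete.prec' (I := N) (M := B)
      (fun n => algebraMap A B (φ (w (K * n)))) (by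
        intro i j hij
        rw [SModEq.sub_mem, smul_eq_mul, Ideal.mul_top, ← map_sub, ← map_sub]
        refine hle i _ ?_
        have h1 := hw (K * i)
        have h2 := hmono (Nat.mul_le_mul_left K hij) (hw (K * j))
        have := sub_mem h2 h1
        rw [map_sub]
        convert this using 1; ring)
    refine ⟨L, fun n v hv => ?_⟩
    have h1 := hL n
    rw [SModEq.sub_mem, smul_eq_mul, Ideal.mul_top] at h1
    have h2 : algebraMap A B (φ (w (K * n) - v)) ∈ N ^ n := by
      refine hle n _ ?_
      have := sub_mem hv (hw (K * n))
      rw [map_sub]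
      convert this using 1; ring
    rw [map_sub, map_sub] at h2
    have := sub_mem h2 h1
    convert this using 1; ring
  choose L hL using hex
  have huniq : ∀ (s y : B), (∀ n, ∃ w : A, s - algebraMap A B w ∈ N ^ (K * n) ∧
      y - algebraMap A B (φ w) ∈ N ^ n) → L s = y := by
    intro s y hy
    refine h.eq_of_forall fun n => ?_
    obtain ⟨w, hw, hw'⟩ := hy n
    have := sub_mem (hL s n w hw) hw'
    convert this using 1; ring
  let ψ : B →+ B := AddMonoidHom.mk' L (by
    intro s s'
    refine huniq _ _ fun n => ?_
    obtain ⟨w, hw⟩ := h.approx s (K * n)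
    obtain ⟨w', hw'⟩ := h.approx s' (K * n)
    refine ⟨w + w', ?_, ?_⟩
    · have := add_mem hw hw'
      rw [map_add]; convert this using 1; ring
    · have := add_mem (hL _ n _ hw) (hL _ n _ hw')
      rw [map_add, map_add]; convert this using 1; ring)
  refine ⟨ψ, fun s x => ?_, fun w => ?_⟩
  · change L (s ^ q * x) = s * L x
    refine huniq _ _ fun n => ?_
    obtain ⟨w, hw⟩ := h.approx s (K * n)
    obtain ⟨v, hv⟩ := h.approx x (K * n)
    refine ⟨w ^ q * v, ?_, ?_⟩
    · rw [← Ideal.Quotient.eq] at hw hv ⊢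
      rw [map_mul, map_pow, hw, hv, map_mul (algebraMap A B), map_pow (algebraMap A B), map_mul,
        map_pow]
    · rw [hφ]
      have h1 := hL _ n _ hv
      have h2 := hmono (Nat.le_mul_of_pos_left n hK0) hw
      rw [← Ideal.Quotient.eq] at h1 h2 ⊢
      simp only [map_mul, h1, h2]
  · change L _ = _
    exact huniq _ _ fun n => ⟨w, by simp, by simp⟩

theorem isPrecomplete_pi {C : Type u} [CommRing C] {I : Ideal C} (hI : I.FG) [IsAdicComplete I C]
    (k : ℕ) : IsPrecomplete I (Fin k → C) := by
  have key : ∀ n (v : Fin k → C), v ∈ (I ^ n • ⊤ : Submodule C (Fin k → C)) ↔ ∀ i, v i ∈ I ^ n := by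
    intro n v
    constructor
    · intro hv i
      refine Submodule.smul_induction_on hv ?_ ?_
      · intro r hr w _; exact Ideal.mul_mem_right _ _ hr
      · intro x y hx hy; exact add_mem hx hy
    · intro hv
      have h2 : v = ∑ i, v i • (Pi.single i (1 : C) : Fin k → C) := by
        ext j; simp [Finset.sum_apply, Pi.single_apply]
      rw [h2]
      exact Submodule.sum_mem _ fun i _ => Submodule.smul_mem_smul (hv i) trivial
  refine ⟨fun f hf => ?_⟩
  have : ∀ i, ∃ L : C, ∀ n, f n i ≡ L [SMOD (I ^ n • ⊤ : Submodule C C)] := fun i =>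
    IsPrecomplete.prec' (fun n => f n i) (by
      intro a b hab
      have := hf hab
      rw [SModEq.sub_mem, key] at this
      rw [SModEq.sub_mem, smul_eq_mul, Ideal.mul_top]
      exact this i)
  choose L hL using this
  refine ⟨L, fun n => ?_⟩
  rw [SModEq.sub_mem, key]
  intro i
  have := hL i n
  rwa [SModEq.sub_mem, smul_eq_mul, Ideal.mul_top] at this

theorem IsCompl'.gen (h : IsCompl' A B m) (hm : m.FG) {p e : ℕ} [hp : Fact p.Prime] [ExpChar B p]
    {k : ℕ} (g : Fin k → A) (hg : ∀ w : A, ∃ c : Fin k → A, w = ∑ i, c i ^ p ^ e * g i) (s : B) :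
    ∃ c : Fin k → B, s = ∑ i, c i ^ p ^ e * algebraMap A B (g i) := by
  set N := m.map (algebraMap A B) with hN
  have := h.complete
  have hNfg : N.FG := hm.map _
  have hpre := isPrecomplete_pi hNfg k
  have hq : 0 < p ^ e := pow_pos hp.out.pos e
  have hle : ∀ n (x : FrobAlg B p e), x ∈ (N ^ n • ⊤ : Submodule B (FrobAlg B p e)) →
      (show B from x) ∈ N ^ n := by
    intro n x hx
    refine Submodule.smul_induction_on (p := fun x : FrobAlg B p e => (show B from x) ∈ N ^ n) hx ?_ ?_
    · intro r hr w _
      rw [frobAlg_smul]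
      exact Ideal.mul_mem_right _ _ (Ideal.pow_mem_of_mem _ hr _ hq)
    · intro x y hx hy; exact add_mem hx hy
  have hge : ∀ x : B, x ∈ frobPow B N (p ^ e) →
      FrobAlg.of B p e x ∈ (N • ⊤ : Submodule B (FrobAlg B p e)) := by
    intro x hx
    suffices H : ∀ r, FrobAlg.of B p e (x * r) ∈ (N • ⊤ : Submodule B (FrobAlg B p e)) by
      simpa using H 1
    refine Submodule.span_induction (p := fun x _ => ∀ r, FrobAlg.of B p e (x * r) ∈
      (N • ⊤ : Submodule B (FrobAlg B p e))) ?_ ?_ ?_ ?_ hx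
    · rintro _ ⟨y, hy, rfl⟩ r
      rw [map_mul, ← frobAlg_smul]
      exact Submodule.smul_mem_smul hy trivial
    · intro r; simp
    · intro x y _ _ h1 h2 r
      rw [add_mul, map_add]; exact add_mem (h1 r) (h2 r)
    · intro a x _ h1 r
      have := h1 (a * r)
      rwa [smul_eq_mul, mul_comm a, mul_assoc]
  have hhaus : IsHausdorff N (FrobAlg B p e) := by
    refine ⟨fun x hx => ?_⟩
    refine h.eq_of_forall (x := (show B from x)) (y := 0) fun n => ?_
    have := hx n
    rw [SModEq.sub_mem] at this
    exact hle n _ this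
  let f : (Fin k → B) →ₗ[B] FrobAlg B p e :=
    Fintype.linearCombination B (fun i => FrobAlg.of B p e (algebraMap A B (g i)))
  have hf : ∀ c, f c = FrobAlg.of B p e (∑ i, c i ^ p ^ e * algebraMap A B (g i)) := by
    intro c
    rw [Fintype.linearCombination_apply, map_sum]
    refine Finset.sum_congr rfl fun i _ => ?_
    rw [frobAlg_smul, map_mul]
  obtain ⟨K, _, hK⟩ := exists_pow_le_frobPow N hNfg (p ^ e)
  have hsurj : Function.Surjective f := by
    refine surjective_of_mkQ_comp_surjective (I := N) fun y => ?_
    obtain ⟨y, rfl⟩ := Submodule.Quotient.mk_surjective _ y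
    obtain ⟨w, hw⟩ := h.approx (show B from y) (K * 1)
    obtain ⟨c, hc⟩ := hg w
    refine ⟨fun i => algebraMap A B (c i), ?_⟩
    rw [LinearMap.comp_apply, hf, Submodule.mkQ_apply]
    symm
    rw [Submodule.Quotient.eq]
    have h1 := hK 1 hw
    rw [pow_one] at h1
    have h2 := hge _ h1
    rw [hc, map_sub, map_sum] at h2
    simp only [map_mul, map_pow, map_sum] at h2 ⊢
    exact h2
  obtain ⟨c, hc⟩ := hsurj (FrobAlg.of B p e s)
  rw [hf] at hc
  exact ⟨c, hc.symm⟩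

end Compl

section Final

variable {A B : Type u} [CommRing A] [CommRing B] [Algebra A B] {m : Ideal A}

theorem WeakBasis.completion (h : IsCompl' A B m) (hm : m.FG) {p : ℕ} [hp : Fact p.Prime]
    [ExpChar A p] [ExpChar B p] (hgen : GenPow A (p ^ 1)) {d : A} (hd : WeakBasis A p d) :
    WeakBasis B p (algebraMap A B d) := by
  obtain ⟨k, φ, g, hφ, hw⟩ := hd
  obtain ⟨l, γ, hγ⟩ := hgen
  choose ψ hψ hψφ using fun i => h.extend hm (hφ i)
  refine ⟨k, ψ, fun i => algebraMap A B (g i), hψ, fun s => ?_⟩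
  obtain ⟨σ, hσ⟩ := h.gen hm (p := p) (e := 1) γ hγ s
  have h1 : ∀ i, (ψ i s) ^ p = ∑ j, σ j ^ p * (algebraMap A B (φ i (γ j))) ^ p := by
    intro i
    conv_lhs => rw [hσ, map_sum, sum_pow_char p]
    refine Finset.sum_congr rfl fun j _ => ?_
    rw [hψ, hψφ, mul_pow]
  simp only [h1, Finset.sum_mul]
  rw [Finset.sum_comm]
  conv_lhs => rw [hσ, Finset.mul_sum]
  refine Finset.sum_congr rfl fun j _ => ?_
  have h2 := congrArg (algebraMap A B) (hw (γ j))
  rw [map_mul, map_sum] at h2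
  rw [mul_left_comm, h2, Finset.mul_sum, pow_one]
  refine Finset.sum_congr rfl fun i _ => ?_
  rw [map_mul, map_pow]; ring

theorem tauC_completion (h : IsCompl' A B m) (hm : m.FG) {p : ℕ} [hp : Fact p.Prime]
    [ExpChar A p] [ExpChar B p] [IsNoetherianRing A] [Module.Flat A B]
    (hfin : ∀ e, Module.Finite A (FrobAlg A p e)) (a : Ideal A) (t : ℚ) (D : A) :
    tauC p (a.map (algebraMap A B)) t (algebraMap A B D) 0 =
      (tauC p a t D 0).map (algebraMap A B) := by
  apply le_antisymm
  · refine Ideal.span_le.2 ?_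
    rintro _ ⟨e, he, φ, hφ, x, hx, rfl⟩
    rw [← Ideal.map_pow] at hx
    obtain ⟨l, γ, hγ⟩ := genPow_of_finite (hfin e)
    let f : FrobAlg A p e →ₗ[A] B :=
      { toFun := fun w => φ (algebraMap A B (show A from w))
        map_add' := fun x y => by
          refine Eq.trans ?_ (map_add φ _ _)
          exact congrArg φ (map_add (algebraMap A B) _ _)
        map_smul' := fun s w => by
          have h1 := hφ (algebraMap A B s) (algebraMap A B (show A from w))
          rw [← map_pow, ← map_mul, ← Algebra.smul_def] at h1
          rw [frobAlg_smul]
          exact h1 }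
    have hFP : Module.FinitePresentation A (FrobAlg A p e) :=
      have := hfin e; Module.finitePresentation_of_finite A _
    obtain ⟨k, h₂, h₃, hh⟩ := Module.Flat.exists_factorization_of_finitePresentation f
    have key : ∀ w ∈ a ^ ⌈t * (p : ℚ) ^ e⌉₊,
        φ (algebraMap A B (D * w)) ∈ (tauC p a t D 0).map (algebraMap A B) := by
      intro w hw
      have h4 : φ (algebraMap A B (D * w)) = h₃ (h₂ (FrobAlg.of A p e (D * w))) :=
        LinearMap.congr_fun hh (FrobAlg.of A p e (D * w))
      rw [h4, ← Finsupp.univ_sum_single (h₂ (FrobAlg.of A p e (D * w))), map_sum]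
      refine Ideal.sum_mem _ fun j _ => ?_
      rw [← Finsupp.smul_single_one, map_smul, Algebra.smul_def]
      refine Ideal.mul_mem_right _ _ (Ideal.mem_map_of_mem _ (Ideal.subset_span ?_))
      exact ⟨e, he, cartOfLin ((Finsupp.lapply j) ∘ₗ h₂), cartOfLin_mem _, w, hw, rfl⟩
    suffices H : ∀ r, φ (algebraMap A B D * (x * r)) ∈ (tauC p a t D 0).map (algebraMap A B) by
      simpa using H 1
    refine Submodule.span_induction (p := fun x _ => ∀ r, φ (algebraMap A B D * (x * r)) ∈
      (tauC p a t D 0).map (algebraMap A B)) ?_ ?_ ?_ ?_ hx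
    · rintro _ ⟨w, hw, rfl⟩ r
      obtain ⟨σ, hσ⟩ := h.gen hm (p := p) (e := e) γ hγ r
      rw [hσ, Finset.mul_sum, Finset.mul_sum, map_sum]
      refine Ideal.sum_mem _ fun j _ => ?_
      have : algebraMap A B D * (algebraMap A B w * (σ j ^ p ^ e * algebraMap A B (γ j))) =
          σ j ^ p ^ e * algebraMap A B (D * (w * γ j)) := by
        rw [map_mul, map_mul]; ring
      rw [this, hφ]
      exact Ideal.mul_mem_left _ _ (key _ (Ideal.mul_mem_right _ _ hw))
    · intro r; simp
    · intro x y _ _ h1 h2 r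
      rw [add_mul, mul_add, map_add]; exact add_mem (h1 r) (h2 r)
    · intro b x _ h1 r
      have := h1 (b * r)
      rwa [smul_eq_mul, mul_comm b, mul_assoc]
  · rw [tauC, Ideal.map_span, Ideal.span_le]
    rintro _ ⟨_, ⟨e, he, φ, hφ, x, hx, rfl⟩, rfl⟩
    obtain ⟨ψ, hψ, hψφ⟩ := h.extend hm hφ
    refine Ideal.subset_span ⟨e, he, ψ, hψ, algebraMap A B x, ?_, ?_⟩
    · rw [← Ideal.map_pow]; exact Ideal.mem_map_of_mem _ hx
    · rw [← map_mul, hψφ]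

end Final

/-- **Proposition 3.2** (Hara–Takagi): completion.  `(R,m)` F-finite reduced (excellent) local of
characteristic `p > 0`, `a ∩ R° ≠ ∅`, `t ≥ 0` rational, `R̂` the `m`-adic completion; if
condition `(*)` holds for `aᵗ` over `R` and for `(a R̂)ᵗ` over `R̂`, then
`τ((a R̂)ᵗ) = τ(aᵗ) R̂`. -/
theorem testIdeal_completion
    (p : ℕ) [Fact p.Prime] [CharP R p] [ExpChar R p]
    [IsNoetherianRing R] [IsReduced R] [IsLocalRing R]
    (hFF : IsFFinite R p)
    (a : Ideal R) (ha : ((a : Set R) ∩ Rcirc R).Nonempty)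
    (t : ℚ) (ht : 0 ≤ t)
    (E : Type u) [AddCommGroup E] [Module R E]
    (hE : IsInjectiveHull R (R ⧸ IsLocalRing.maximalIdeal R) E)
    (hstar : testIdeal R p a t = tildeTau R p a t E)
    [IsLocalRing (AdicCompletion (IsLocalRing.maximalIdeal R) R)]
    [ExpChar (AdicCompletion (IsLocalRing.maximalIdeal R) R) p]
    (Ehat : Type u) [AddCommGroup Ehat]
    [Module (AdicCompletion (IsLocalRing.maximalIdeal R) R) Ehat]
    (hEhat : IsInjectiveHull (AdicCompletion (IsLocalRing.maximalIdeal R) R)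
      (AdicCompletion (IsLocalRing.maximalIdeal R) R ⧸
        IsLocalRing.maximalIdeal (AdicCompletion (IsLocalRing.maximalIdeal R) R)) Ehat)
    (hstar' : testIdeal (AdicCompletion (IsLocalRing.maximalIdeal R) R) p
        (a.map (algebraMap R (AdicCompletion (IsLocalRing.maximalIdeal R) R))) t
      = tildeTau (AdicCompletion (IsLocalRing.maximalIdeal R) R) p
        (a.map (algebraMap R (AdicCompletion (IsLocalRing.maximalIdeal R) R))) t Ehat) :
    testIdeal (AdicCompletion (IsLocalRing.maximalIdeal R) R) p
        (a.map (algebraMap R (AdicCompletion (IsLocalRing.maximalIdeal R) R))) t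
      = (testIdeal R p a t).map
          (algebraMap R (AdicCompletion (IsLocalRing.maximalIdeal R) R)) := by
  have hmfg : (IsLocalRing.maximalIdeal R).FG := IsNoetherian.noetherian _
  have hC := isCompl_adicCompletion (IsLocalRing.maximalIdeal R) hmfg
  have hN : IsNoetherianRing (AdicCompletion (IsLocalRing.maximalIdeal R) R) := hC.isNoetherianRing
  have hgen1 : GenPow R (p ^ 1) := genPow_of_finite hFF
  have hfin : ∀ e, Module.Finite R (FrobAlg R p e) := fun e =>
    finite_of_genPow (genPow_pow hgen1 e)
  have hfin' : ∀ e, Module.Finite (AdicCompletion (IsLocalRing.maximalIdeal R) R) (FrobAlg (AdicCompletion (IsLocalRing.maximalIdeal R) R) p e) := by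
    intro e
    obtain ⟨k, g, hg⟩ := genPow_of_finite (hfin e)
    exact finite_of_genPow ⟨k, _, fun s => hC.gen hmfg g hg s⟩
  obtain ⟨d, hd, hwb⟩ := exists_weakBasis (A := R) p hFF
  have hwb' := hwb.completion hC hmfg hgen1
  have hd' : algebraMap R (AdicCompletion (IsLocalRing.maximalIdeal R) R) d ∈ nonZeroDivisors (AdicCompletion (IsLocalRing.maximalIdeal R) R) := by
    have h1 : IsSMulRegular R d := by
      intro x y hxy
      exact (mul_cancel_left_mem_nonZeroDivisors hd).1 hxy
    have h2 : IsSMulRegular (AdicCompletion (IsLocalRing.maximalIdeal R) R) (algebraMap R (AdicCompletion (IsLocalRing.maximalIdeal R) R) d) := h1.of_flat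
    rw [mem_nonZeroDivisors_iff_right]
    intro x hx
    refine h2 (?_ : _ • x = _ • (0 : AdicCompletion (IsLocalRing.maximalIdeal R) R))
    rw [smul_zero, smul_eq_mul, mul_comm, hx]
  rw [hstar', hstar, mem_tildeTau_iff' p hfin hE a t hd hwb,
    mem_tildeTau_iff' p hfin' hEhat _ t hd' hwb', ← map_pow]
  exact tauC_completion hC hmfg hfin a t _
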